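/- Assume the main configuration, with Z ≠ P and no three of A, B, C, P, X collinear. Let I ≠ P be a point lying on both line PZ and the conic (ABCPX). Then I lies on line XY. -/

import Mathlib

noncomputable section

/-- The line through the points `u` and `v`. -/
def lineThrough (u v : ℂ) : Set ℂ := {z : ℂ | ∃ t : ℝ, z = u + t • (v - u)}

/-- A subset of `ℂ` is a line if it is the line through two distinct points. -/
def IsLine (L : Set ℂ) : Prop := ∃ u v : ℂ, u ≠ v ∧ L = lineThrough u v

/-- The circle with center `O` and radius `r`. -/
def circleSet (O : ℂ) (r : ℝ) : Set ℂ := {z : ℂ | ‖z - O‖ = r}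

/-- The value at `z` of the real quadratic polynomial with coefficients `a, b, c, d, e, f`
in the coordinates `x = Re z`, `y = Im z`. -/
def conicEval (a b c d e f : ℝ) (z : ℂ) : ℝ :=
  a * z.re ^ 2 + b * z.re * z.im + c * z.im ^ 2 + d * z.re + e * z.im + f

/-- The gradient at `z` of the real quadratic polynomial with coefficients
`a, b, c, d, e, f`, regarded as a complex number. -/
def conicGrad (a b c d e f : ℝ) (z : ℂ) : ℂ :=
  ((2 * a * z.re + b * z.im + d : ℝ) : ℂ) + ((b * z.re + 2 * c * z.im + e : ℝ) : ℂ) * Complex.I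

/-- A conic: the zero set of a nonzero real polynomial of total degree at most 2 in the
coordinates `x = Re z`, `y = Im z`. -/
def IsConic (S : Set ℂ) : Prop :=
  ∃ a b c d e f : ℝ, ¬(a = 0 ∧ b = 0 ∧ c = 0 ∧ d = 0 ∧ e = 0 ∧ f = 0) ∧
    S = {z : ℂ | conicEval a b c d e f z = 0}

/-- The line through `Z` perpendicular to the (nonzero) vector `g`. -/
def perpLineAt (Z g : ℂ) : Set ℂ :=
  {w : ℂ | (w - Z).re * g.re + (w - Z).im * g.im = 0}

/-- `L` is the tangent line of the conic `S` at the point `Z`: for some defining polynomial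
`f` of `S` vanishing at `Z` with `∇f(Z) ≠ 0`, `L` is the line through `Z` perpendicular
to `∇f(Z)`. -/
def IsConicTangentLineAt (S : Set ℂ) (Z : ℂ) (L : Set ℂ) : Prop :=
  ∃ a b c d e f : ℝ, ¬(a = 0 ∧ b = 0 ∧ c = 0 ∧ d = 0 ∧ e = 0 ∧ f = 0) ∧
    S = {z : ℂ | conicEval a b c d e f z = 0} ∧
    conicEval a b c d e f Z = 0 ∧ conicGrad a b c d e f Z ≠ 0 ∧
    L = perpLineAt Z (conicGrad a b c d e f Z)

/-- The circle with center `O` and radius `r` and the conic `S` are tangent at `Z`: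
both pass through `Z` and the tangent line of the circle at `Z` (the line through `Z`
perpendicular to the radius) is the tangent line of the conic at `Z`. -/
def CircleConicTangentAt (O : ℂ) (r : ℝ) (S : Set ℂ) (Z : ℂ) : Prop :=
  Z ∈ circleSet O r ∧ Z ∈ S ∧ IsConicTangentLineAt S Z (perpLineAt Z (Z - O))

/-- `P` and `P'` are isogonal conjugates with respect to the triangle `ABC`. -/
def IsogConj (A B C P P' : ℂ) : Prop :=
  ((P - A) * (P' - A) / ((B - A) * (C - A))).im = 0 ∧
  ((P - B) * (P' - B) / ((C - B) * (A - B))).im = 0 ∧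
  ((P - C) * (P' - C) / ((A - C) * (B - C))).im = 0

/-- No three of the points in the list `l` are collinear. -/
def NoThreeCollinear (l : List ℂ) : Prop :=
  ∀ i j k : Fin l.length, i ≠ j → i ≠ k → j ≠ k →
    ¬ Collinear ℝ ({l.get i, l.get j, l.get k} : Set ℂ)

/-- Four points lie on a common circle. -/
def Concyclic4 (A B C D : ℂ) : Prop :=
  ∃ O : ℂ, ∃ r : ℝ, 0 < r ∧ A ∈ circleSet O r ∧ B ∈ circleSet O r ∧
    C ∈ circleSet O r ∧ D ∈ circleSet O r

/-- Orthogonal reflection of `z` across the line through `u` with direction `v`. -/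
def reflAcross (u v z : ℂ) : ℂ :=
  u + v / (starRingEnd ℂ) v * (starRingEnd ℂ) (z - u)

/-- `O'` is a center of `S`: the point reflection about `O'` maps `S` onto itself. -/
def IsCenter (S : Set ℂ) (O' : ℂ) : Prop :=
  (fun z => 2 * O' - z) '' S = S


theorem NoThreeCollinear.not_collinear {A B C P Q : ℂ} (h : NoThreeCollinear [A, B, C, P, Q])
    (i j k : Fin 5) (hijk : i ≠ j ∧ i ≠ k ∧ j ≠ k := by decide) :
    ¬ Collinear ℝ ({[A, B, C, P, Q].get i, [A, B, C, P, Q].get j, [A, B, C, P, Q].get k} :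
      Set ℂ) :=
  h i j k hijk.1 hijk.2.1 hijk.2.2

/-- The signed area of the parallelogram spanned by `z` and `w`. -/
def cross (z w : ℂ) : ℝ := z.re * w.im - z.im * w.re

/-- The point with affine coordinates `z.re`, `z.im` in the frame with origin `D` and basis
`u`, `v`. -/
def frame (D u v z : ℂ) : ℂ := D + z.re • u + z.im • v

theorem cross_frame (D u v z₁ z₂ z₃ : ℂ) :
    cross (frame D u v z₂ - frame D u v z₁) (frame D u v z₃ - frame D u v z₁) =
      cross u v * cross (z₂ - z₁) (z₃ - z₁) := by
  simp [cross, frame]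
  ring

theorem exists_frame_eq {D u v : ℂ} (huv : cross u v ≠ 0) (w : ℂ) : ∃ z, frame D u v z = w := by
  refine ⟨⟨cross (w - D) v / cross u v, cross u (w - D) / cross u v⟩, ?_⟩
  apply Complex.ext <;> simp [frame] <;> field_simp <;> simp [cross] <;> ring

theorem exists_eq_add_smul_of_cross_eq_zero {A B C : ℂ} (hAB : A ≠ B)
    (h : cross (B - A) (C - A) = 0) : ∃ t : ℝ, C = A + t • (B - A) := by
  have hne : (B - A).re ^ 2 + (B - A).im ^ 2 ≠ 0 := by
    intro h0
    apply hAB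
    simp only [Complex.sub_re, Complex.sub_im] at h0
    apply Complex.ext <;> nlinarith [sq_nonneg (B.re - A.re), sq_nonneg (B.im - A.im)]
  refine ⟨((C - A).re * (B - A).re + (C - A).im * (B - A).im) /
    ((B - A).re ^ 2 + (B - A).im ^ 2), ?_⟩
  simp only [cross, Complex.sub_re, Complex.sub_im] at h hne
  apply Complex.ext <;>
    simp only [Complex.add_re, Complex.add_im, Complex.smul_re, Complex.smul_im, smul_eq_mul,
      Complex.sub_re, Complex.sub_im] <;> field_simp
  · linear_combination -(B.im - A.im) * h
  · linear_combination (B.re - A.re) * h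

theorem cross_ne_zero_of_not_collinear {A B C : ℂ}
    (h : ¬ Collinear ℝ ({A, B, C} : Set ℂ)) : cross (B - A) (C - A) ≠ 0 := by
  intro h0
  apply h
  by_cases hAB : A = B
  · subst hAB
    simpa using collinear_pair ℝ A C
  obtain ⟨t, ht⟩ := exists_eq_add_smul_of_cross_eq_zero hAB h0
  rw [collinear_iff_of_mem (p₀ := A) (by simp)]
  refine ⟨B - A, ?_⟩
  rintro p (rfl | rfl | rfl)
  · exact ⟨0, by simp⟩
  · exact ⟨1, by simp⟩
  · exact ⟨t, by rw [ht]; simp [add_comm]⟩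

theorem cross_ne_zero_of_not_collinear_frame {D u v z₁ z₂ z₃ : ℂ}
    (h : ¬ Collinear ℝ ({frame D u v z₁, frame D u v z₂, frame D u v z₃} : Set ℂ)) :
    cross (z₂ - z₁) (z₃ - z₁) ≠ 0 := by
  have := cross_ne_zero_of_not_collinear h
  rw [cross_frame] at this
  exact right_ne_zero_of_mul this

theorem exists_conicEval_frame (D u v : ℂ) (a b c d e f : ℝ) :
    ∃ a' b' d' e' f' : ℝ, ∀ z, conicEval a b c d e f (frame D u v z) =
      conicEval a' b' (a * v.re ^ 2 + b * v.re * v.im + c * v.im ^ 2) d' e' f' z := by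
  refine ⟨a * u.re ^ 2 + b * u.re * u.im + c * u.im ^ 2,
    2 * a * u.re * v.re + b * (u.re * v.im + u.im * v.re) + 2 * c * u.im * v.im,
    2 * a * D.re * u.re + b * (D.re * u.im + D.im * u.re) + 2 * c * D.im * u.im
      + d * u.re + e * u.im,
    2 * a * D.re * v.re + b * (D.re * v.im + D.im * v.re) + 2 * c * D.im * v.im
      + d * v.re + e * v.im,
    conicEval a b c d e f D, fun z => ?_⟩
  simp [conicEval, frame]
  ring

/-- A polynomial of degree at most two vanishing on the whole plane is zero. -/
theorem coeff_eq_zero_of_conicEval_eq_zero {a b c d e f : ℝ}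
    (h : ∀ z, conicEval a b c d e f z = 0) :
    a = 0 ∧ b = 0 ∧ c = 0 ∧ d = 0 ∧ e = 0 ∧ f = 0 := by
  have h₀ := h 0
  have h₁ := h ⟨1, 0⟩
  have h₂ := h ⟨-1, 0⟩
  have h₃ := h ⟨0, 1⟩
  have h₄ := h ⟨0, -1⟩
  have h₅ := h ⟨1, 1⟩
  simp only [conicEval, Complex.zero_re, Complex.zero_im] at *
  refine ⟨?_, ?_, ?_, ?_, ?_, ?_⟩ <;> linarith

/-- In an affine frame a conic is given by a nonzero polynomial of degree at most two. -/
theorem IsConic.exists_conicEval_frame {S : Set ℂ} (hS : IsConic S) {D u v : ℂ}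
    (huv : cross u v ≠ 0) :
    ∃ a b c d e f : ℝ, ¬(a = 0 ∧ b = 0 ∧ c = 0 ∧ d = 0 ∧ e = 0 ∧ f = 0) ∧
      ∀ z, frame D u v z ∈ S ↔ conicEval a b c d e f z = 0 := by
  obtain ⟨a, b, c, d, e, f, hne, rfl⟩ := hS
  obtain ⟨a', b', d', e', f', h⟩ := _root_.exists_conicEval_frame D u v a b c d e f
  refine ⟨a', b', _, d', e', f', fun h0 => hne ?_, fun z => by rw [← h z]; rfl⟩
  apply coeff_eq_zero_of_conicEval_eq_zero
  intro w
  obtain ⟨z, rfl⟩ := exists_frame_eq (D := D) huv w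
  obtain ⟨h₁, h₂, h₃, h₄, h₅, h₆⟩ := h0
  rw [h z, h₁, h₂, h₃, h₄, h₅, h₆]
  simp [conicEval]

/-- In an affine frame with basis `u`, `v` a circle is given by a polynomial of degree two in which
the square of the second coordinate has a nonzero coefficient. -/
theorem exists_conicEval_frame_of_circle (O : ℂ) (r : ℝ) {D u v : ℂ} (huv : cross u v ≠ 0) :
    ∃ a b c d e f : ℝ, c ≠ 0 ∧
      ∀ z, frame D u v z ∈ circleSet O r → conicEval a b c d e f z = 0 := by
  obtain ⟨a', b', d', e', f', h⟩ := exists_conicEval_frame D u v 1 0 1 (-2 * O.re) (-2 * O.im)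
    (O.re ^ 2 + O.im ^ 2 - r ^ 2)
  refine ⟨a', b', 1 * v.re ^ 2 + 0 * v.re * v.im + 1 * v.im ^ 2, d', e', f',
    fun h0 => huv ?_, fun z hz => ?_⟩
  · have hre : v.re = 0 := by nlinarith [sq_nonneg v.re, sq_nonneg v.im]
    have him : v.im = 0 := by nlinarith [sq_nonneg v.re, sq_nonneg v.im]
    simp [cross, hre, him]
  · rw [← h z]
    have hz' : ‖frame D u v z - O‖ ^ 2 = r ^ 2 := by rw [show ‖frame D u v z - O‖ = r from hz]
    rw [← Complex.normSq_eq_norm_sq, Complex.normSq_apply] at hz'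
    simp only [conicEval, Complex.sub_re, Complex.sub_im] at hz' ⊢
    linarith

/-- An affine function vanishing at three noncollinear points is zero. -/
theorem affine_eq_zero_of_cross_ne_zero {p q r : ℝ} {A B C : ℂ}
    (hABC : cross (B - A) (C - A) ≠ 0)
    (hA : p * A.re + q * A.im + r = 0) (hB : p * B.re + q * B.im + r = 0)
    (hC : p * C.re + q * C.im + r = 0) : p = 0 ∧ q = 0 ∧ r = 0 := by
  simp only [cross, Complex.sub_re, Complex.sub_im] at hABC
  have hp : p = 0 := by
    apply (mul_eq_zero.mp _).resolve_left hABC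
    linear_combination (C.im - A.im) * (hB - hA) - (B.im - A.im) * (hC - hA)
  have hq : q = 0 := by
    apply (mul_eq_zero.mp _).resolve_left hABC
    linear_combination (B.re - A.re) * (hC - hA) - (C.re - A.re) * (hB - hA)
  refine ⟨hp, hq, ?_⟩
  rw [hp, hq] at hA
  linarith

/-- A polynomial of degree at most two vanishing on the real axis and at three noncollinear
points off the real axis is zero. -/
theorem coeff_eq_zero_of_real_axis {a b c d e f : ℝ} {A B C : ℂ}
    (hABC : cross (B - A) (C - A) ≠ 0)
    (hA0 : A.im ≠ 0) (hB0 : B.im ≠ 0) (hC0 : C.im ≠ 0)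
    (ha : a = 0) (hd : d = 0) (hf : f = 0)
    (hA : conicEval a b c d e f A = 0) (hB : conicEval a b c d e f B = 0)
    (hC : conicEval a b c d e f C = 0) :
    a = 0 ∧ b = 0 ∧ c = 0 ∧ d = 0 ∧ e = 0 ∧ f = 0 := by
  subst ha hd hf
  simp only [conicEval] at hA hB hC
  obtain ⟨h₁, h₂, h₃⟩ := affine_eq_zero_of_cross_ne_zero (p := b) (q := c) (r := e) hABC
    ((mul_eq_zero.mp (by linear_combination hA)).resolve_left hA0)
    ((mul_eq_zero.mp (by linear_combination hB)).resolve_left hB0)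
    ((mul_eq_zero.mp (by linear_combination hC)).resolve_left hC0)
  exact ⟨rfl, h₁, h₂, rfl, h₃, rfl⟩

/-- If a conic passes through `P`, `P'` and three noncollinear points off the line `PP'`, then it
has no further point `D` on that line. -/
theorem cross_ne_zero_of_mem_conic {S : Set ℂ} (hS : IsConic S) {A B C P P' D : ℂ}
    (hABC : cross (B - A) (C - A) ≠ 0) (hPP' : P ≠ P')
    (hA : cross (P' - P) (A - P) ≠ 0) (hB : cross (P' - P) (B - P) ≠ 0)
    (hC : cross (P' - P) (C - P) ≠ 0) (hDP : D ≠ P) (hDP' : D ≠ P')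
    (hAS : A ∈ S) (hBS : B ∈ S) (hCS : C ∈ S) (hPS : P ∈ S) (hP'S : P' ∈ S) (hDS : D ∈ S) :
    cross (P - D) (P' - D) ≠ 0 := by
  intro h0
  obtain ⟨t, rfl⟩ := exists_eq_add_smul_of_cross_eq_zero (C := D) hPP' (by
    simp only [cross, Complex.sub_re, Complex.sub_im] at h0 ⊢
    linarith)
  have ht0 : t ≠ 0 := by rintro rfl; simp at hDP
  have ht1 : t - 1 ≠ 0 := by
    intro h
    rw [sub_eq_zero.mp h] at hDP'
    simp at hDP'
  obtain ⟨a, b, c, d, e, f, hne, h⟩ := hS.exists_conicEval_frame (D := P) hA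
  obtain ⟨A', hA'⟩ := exists_frame_eq (D := P) hA A
  obtain ⟨B', hB'⟩ := exists_frame_eq (D := P) hA B
  obtain ⟨C', hC'⟩ := exists_frame_eq (D := P) hA C
  have hP0 : frame P (P' - P) (A - P) 0 = P := by simp [frame]
  have hP1 : frame P (P' - P) (A - P) 1 = P' := by simp [frame]
  have hD0 : frame P (P' - P) (A - P) t = P + t • (P' - P) := by simp [frame]
  have him : ∀ W : ℂ, cross (P' - P) (frame P (P' - P) (A - P) W - P) ≠ 0 → W.im ≠ 0 := by
    intro W hW h0
    apply hW
    simp [frame, cross, h0]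
    ring
  rw [← hP0, h] at hPS
  rw [← hP1, h] at hP'S
  rw [← hD0, h] at hDS
  simp only [conicEval, Complex.zero_re, Complex.zero_im, Complex.one_re, Complex.one_im,
    Complex.ofReal_re, Complex.ofReal_im] at hPS hP'S hDS
  have hf : f = 0 := by linarith
  have ha : a = 0 := by
    apply (mul_eq_zero.mp _).resolve_left (mul_ne_zero ht0 ht1)
    linear_combination hDS - t * hP'S + (t - 1) * hf
  have hd : d = 0 := by linarith
  rw [← hA'] at hABC hAS
  rw [← hB'] at hABC hB hBS
  rw [← hC'] at hABC hC hCS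
  rw [cross_frame] at hABC
  exact hne (coeff_eq_zero_of_real_axis (right_ne_zero_of_mul hABC)
    (him _ (by rwa [hA'])) (him _ hB) (him _ hC)
    ha hd hf ((h _).mp hAS) ((h _).mp hBS) ((h _).mp hCS))

/-- Let a nonzero polynomial of degree at most two vanish at `0`, `1`, `i` and at `A ≠ 0`, `B`,
`C`, where `1`, `B`, `C` are not collinear and neither `B` nor `C` is on the line through `A` and
`i`. Then `A` is off the imaginary axis. -/
theorem re_ne_zero_of_conicEval {a b c d e f : ℝ}
    (hne : ¬(a = 0 ∧ b = 0 ∧ c = 0 ∧ d = 0 ∧ e = 0 ∧ f = 0)) {A B C : ℂ}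
    (hBC : cross (B - 1) (C - 1) ≠ 0)
    (hAB : cross (B - A) (Complex.I - A) ≠ 0) (hAC : cross (C - A) (Complex.I - A) ≠ 0)
    (hA0 : A ≠ 0)
    (h0 : conicEval a b c d e f 0 = 0) (h1 : conicEval a b c d e f 1 = 0)
    (hI : conicEval a b c d e f Complex.I = 0) (hA : conicEval a b c d e f A = 0)
    (hB : conicEval a b c d e f B = 0) (hC : conicEval a b c d e f C = 0) : A.re ≠ 0 := by
  intro hre
  have him : A.im ≠ 0 := fun h => hA0 (Complex.ext hre h)
  simp only [conicEval, cross, Complex.zero_re, Complex.zero_im, Complex.one_re, Complex.one_im,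
    Complex.I_re, Complex.I_im, Complex.sub_re, Complex.sub_im, hre] at *
  have him1 : A.im - 1 ≠ 0 := by
    intro h
    apply hAB
    linear_combination -B.re * h
  have hBre : B.re ≠ 0 := by intro h; apply hAB; rw [h]; ring
  have hCre : C.re ≠ 0 := by intro h; apply hAC; rw [h]; ring
  have hf : f = 0 := by linarith
  have hc : c = 0 := by
    apply (mul_eq_zero.mp _).resolve_left (mul_ne_zero him him1)
    linear_combination hA - A.im * hI + (A.im - 1) * hf
  have he : e = 0 := by linarith
  subst hf hc he
  obtain ⟨h₁, h₂, h₃⟩ := affine_eq_zero_of_cross_ne_zero (A := 1) (B := B) (C := C)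
    (p := a) (q := b) (r := d) (by simpa [cross] using hBC)
    (by simp; linarith)
    ((mul_eq_zero.mp (by linear_combination hB)).resolve_left hBre)
    ((mul_eq_zero.mp (by linear_combination hC)).resolve_left hCre)
  exact hne ⟨h₁, h₂, rfl, h₃, rfl, rfl⟩

/-- A nonzero polynomial of degree at most two vanishing at `1`, `i` and three noncollinear points
off the line through `1` and `i` vanishes nowhere else on that line. -/
theorem eq_zero_or_eq_one_of_conicEval {a b c d e f : ℝ}
    (hne : ¬(a = 0 ∧ b = 0 ∧ c = 0 ∧ d = 0 ∧ e = 0 ∧ f = 0)) {A B C : ℂ}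
    (hABC : cross (B - A) (C - A) ≠ 0)
    (hA0 : A.re + A.im - 1 ≠ 0) (hB0 : B.re + B.im - 1 ≠ 0) (hC0 : C.re + C.im - 1 ≠ 0)
    (h1 : conicEval a b c d e f 1 = 0) (hI : conicEval a b c d e f Complex.I = 0)
    (hA : conicEval a b c d e f A = 0) (hB : conicEval a b c d e f B = 0)
    (hC : conicEval a b c d e f C = 0) {τ : ℝ} (hτ : conicEval a b c d e f ⟨1 - τ, τ⟩ = 0) :
    τ = 0 ∨ τ = 1 := by
  by_contra! hτ01
  simp only [conicEval, Complex.one_re, Complex.one_im, Complex.I_re, Complex.I_im] at *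
  have habc : a - b + c = 0 := by
    apply (mul_eq_zero.mp _).resolve_left (mul_ne_zero hτ01.1 (sub_ne_zero.mpr hτ01.2))
    linear_combination hτ - (1 - τ) * h1 - τ * hI
  have hd : d = -a - f := by linarith
  have he : e = -c - f := by linarith
  have hb : b = a + c := by linarith
  subst hd he hb
  obtain ⟨h₁, h₂, h₃⟩ := affine_eq_zero_of_cross_ne_zero (p := a) (q := c) (r := -f) hABC
    ((mul_eq_zero.mp (by linear_combination hA)).resolve_left hA0)
    ((mul_eq_zero.mp (by linear_combination hB)).resolve_left hB0)
    ((mul_eq_zero.mp (by linear_combination hC)).resolve_left hC0)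
  apply hne
  refine ⟨?_, ?_, ?_, ?_, ?_, ?_⟩ <;> linarith

/-- The theorem in the affine frame where `D = 0`, `P = 1`, `P' = i`, `X = s` and `Y = t i`, with
an arbitrary conic `w` in place of the circle. The cubics `w · PP'`, `h · XY` and `k · DY` pass
through `A`, `B`, `C`, `D`, `X`, `Y`, `P`, `P'`, hence are linearly dependent. -/
theorem collinear_of_conics_in_frame {A B C : ℂ} {s t τ : ℝ}
    {h₁ h₂ h₃ h₄ h₅ h₆ w₁ w₂ w₃ w₄ w₅ w₆ k₁ k₂ k₃ k₄ k₅ k₆ : ℝ}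
    (hABC : cross (B - A) (C - A) ≠ 0)
    (hAre : A.re ≠ 0) (hBre : B.re ≠ 0) (hCre : C.re ≠ 0)
    (hAim : A.im ≠ 0) (hBim : B.im ≠ 0) (hCim : C.im ≠ 0)
    (hA1 : A.re + A.im - 1 ≠ 0) (hB1 : B.re + B.im - 1 ≠ 0) (hC1 : C.re + C.im - 1 ≠ 0)
    (hs : s ≠ 0) (hs1 : s ≠ 1) (ht : t ≠ 0) (hτ : τ ≠ 0)
    (hh : ¬(h₁ = 0 ∧ h₂ = 0 ∧ h₃ = 0 ∧ h₄ = 0 ∧ h₅ = 0 ∧ h₆ = 0)) (hw : w₃ ≠ 0)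
    (hk : ¬(k₁ = 0 ∧ k₂ = 0 ∧ k₃ = 0 ∧ k₄ = 0 ∧ k₅ = 0 ∧ k₆ = 0))
    (hhA : conicEval h₁ h₂ h₃ h₄ h₅ h₆ A = 0) (hhB : conicEval h₁ h₂ h₃ h₄ h₅ h₆ B = 0)
    (hhC : conicEval h₁ h₂ h₃ h₄ h₅ h₆ C = 0) (hhD : conicEval h₁ h₂ h₃ h₄ h₅ h₆ 0 = 0)
    (hhP : conicEval h₁ h₂ h₃ h₄ h₅ h₆ 1 = 0) (hhP' : conicEval h₁ h₂ h₃ h₄ h₅ h₆ Complex.I = 0)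
    (hwA : conicEval w₁ w₂ w₃ w₄ w₅ w₆ A = 0) (hwB : conicEval w₁ w₂ w₃ w₄ w₅ w₆ B = 0)
    (hwC : conicEval w₁ w₂ w₃ w₄ w₅ w₆ C = 0) (hwD : conicEval w₁ w₂ w₃ w₄ w₅ w₆ 0 = 0)
    (hwX : conicEval w₁ w₂ w₃ w₄ w₅ w₆ s = 0) (hwY : conicEval w₁ w₂ w₃ w₄ w₅ w₆ ⟨0, t⟩ = 0)
    (hkA : conicEval k₁ k₂ k₃ k₄ k₅ k₆ A = 0) (hkB : conicEval k₁ k₂ k₃ k₄ k₅ k₆ B = 0)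
    (hkC : conicEval k₁ k₂ k₃ k₄ k₅ k₆ C = 0) (hkP : conicEval k₁ k₂ k₃ k₄ k₅ k₆ 1 = 0)
    (hkX : conicEval k₁ k₂ k₃ k₄ k₅ k₆ s = 0) (hkI : conicEval k₁ k₂ k₃ k₄ k₅ k₆ ⟨1 - τ, τ⟩ = 0) :
    t * (1 - τ) + s * τ = s * t := by
  have hh₆ : h₆ = 0 := by simpa [conicEval] using hhD
  have hh₄ : h₄ = -h₁ := by simp [conicEval] at hhP; linarith
  have hh₅ : h₅ = -h₃ := by simp [conicEval] at hhP'; linarith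
  have hw₆ : w₆ = 0 := by simpa [conicEval] using hwD
  have hw₄ : w₄ = -s * w₁ := by
    simp [conicEval] at hwX
    apply mul_left_cancel₀ hs
    linear_combination hwX - hw₆
  have hw₅ : w₅ = -t * w₃ := by
    simp [conicEval] at hwY
    apply mul_left_cancel₀ ht
    linear_combination hwY - hw₆
  simp only [conicEval, Complex.one_re, Complex.one_im, Complex.ofReal_re, Complex.ofReal_im]
    at hkP hkX
  have hk₄ : k₄ = -(1 + s) * k₁ := by
    apply mul_left_cancel₀ (sub_ne_zero.mpr hs1)
    linear_combination hkX - hkP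
  have hk₆ : k₆ = s * k₁ := by linarith
  have hk₁ : k₁ ≠ 0 := by
    intro h
    exact hk (coeff_eq_zero_of_real_axis hABC hAim hBim hCim h (by simp [hk₄, h])
      (by simp [hk₆, h]) hkA hkB hkC)
  -- `q` is the quotient of a combination of `w · PP'` and `h · XY` by the equation of `DY`.
  obtain ⟨q₂, q₃, q₅, hq⟩ : ∃ q₂ q₃ q₅ : ℝ, ∀ z : ℂ,
      z.re * conicEval (s * h₃ * w₁ - t * w₃ * h₁) q₂ q₃
        (-(1 + s) * (s * h₃ * w₁ - t * w₃ * h₁)) q₅ (s * (s * h₃ * w₁ - t * w₃ * h₁)) z =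
      s * h₃ * (z.re + z.im - 1) * conicEval w₁ w₂ w₃ w₄ w₅ w₆ z -
        w₃ * (t * z.re + s * z.im - s * t) * conicEval h₁ h₂ h₃ h₄ h₅ h₆ z := by
    refine ⟨s * h₃ * (w₁ + w₂) - w₃ * (h₁ * s + h₂ * t),
      s * h₃ * (w₂ + w₃) - w₃ * (h₂ * s + h₃ * t),
      s * h₃ * (-s * w₁ - w₂ - t * w₃) - w₃ * (-h₁ * s - h₂ * s * t - h₃ * t), fun z => ?_⟩
    rw [hh₆, hh₄, hh₅, hw₆, hw₄, hw₅]
    simp only [conicEval]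
    ring
  set q₁ := s * h₃ * w₁ - t * w₃ * h₁
  have hqz : ∀ z : ℂ, z.re ≠ 0 → conicEval w₁ w₂ w₃ w₄ w₅ w₆ z = 0 →
      conicEval h₁ h₂ h₃ h₄ h₅ h₆ z = 0 →
      conicEval q₁ q₂ q₃ (-(1 + s) * q₁) q₅ (s * q₁) z = 0 := by
    intro z hz hwz hhz
    have := hq z
    rw [hwz, hhz] at this
    exact (mul_eq_zero.mp (by linarith)).resolve_left hz
  have hcomb : ∀ l₁ l₂ l₃ l₄ l₅ l₆ m n : ℝ, ∀ z : ℂ,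
      conicEval (m * k₁ - n * l₁) (m * k₂ - n * l₂) (m * k₃ - n * l₃) (m * k₄ - n * l₄)
        (m * k₅ - n * l₅) (m * k₆ - n * l₆) z =
      m * conicEval k₁ k₂ k₃ k₄ k₅ k₆ z - n * conicEval l₁ l₂ l₃ l₄ l₅ l₆ z := by
    intros
    simp only [conicEval]
    ring
  have hqI : conicEval q₁ q₂ q₃ (-(1 + s) * q₁) q₅ (s * q₁) ⟨1 - τ, τ⟩ = 0 := by
    have hc := hcomb q₁ q₂ q₃ (-(1 + s) * q₁) q₅ (s * q₁) q₁ k₁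
    obtain ⟨e₁, e₂, e₃, e₄, e₅, e₆⟩ := coeff_eq_zero_of_real_axis
      (a := q₁ * k₁ - k₁ * q₁) (d := q₁ * k₄ - k₁ * (-(1 + s) * q₁))
      (f := q₁ * k₆ - k₁ * (s * q₁)) hABC hAim hBim hCim
      (by ring) (by rw [hk₄]; ring) (by rw [hk₆]; ring)
      (by rw [hc A, hkA, hqz A hAre hwA hhA]; ring)
      (by rw [hc B, hkB, hqz B hBre hwB hhB]; ring)
      (by rw [hc C, hkC, hqz C hCre hwC hhC]; ring)
    have hI := hc ⟨1 - τ, τ⟩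
    rw [e₁, e₂, e₃, e₄, e₅, e₆, hkI] at hI
    apply (mul_eq_zero.mp _).resolve_left hk₁
    simp only [conicEval] at hI ⊢
    linarith
  have hprod := hq ⟨1 - τ, τ⟩
  rw [hqI] at hprod
  have hprod' : (w₃ * (t * (1 - τ) + s * τ - s * t)) *
      conicEval h₁ h₂ h₃ h₄ h₅ h₆ ⟨1 - τ, τ⟩ = 0 := by
    linear_combination hprod
  rcases mul_eq_zero.mp hprod' with h | h
  · exact sub_eq_zero.mp ((mul_eq_zero.mp h).resolve_left hw)
  exfalso
  have hτ1 := (eq_zero_or_eq_one_of_conicEval hh hABC hA1 hB1 hC1 hhP hhP' hhA hhB hhC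
    h).resolve_left hτ
  -- The conics `h` and `k` would share the five points `A`, `B`, `C`, `P`, `P'`.
  have hkP' : conicEval k₁ k₂ k₃ k₄ k₅ k₆ Complex.I = 0 := by
    rw [hτ1] at hkI
    simpa [conicEval] using hkI
  obtain ⟨m, n, hmn, hmn2⟩ : ∃ m n : ℝ, ¬(m = 0 ∧ n = 0) ∧
      m * conicEval k₁ k₂ k₃ k₄ k₅ k₆ ⟨1 - 2, 2⟩ -
        n * conicEval h₁ h₂ h₃ h₄ h₅ h₆ ⟨1 - 2, 2⟩ = 0 := by
    by_cases h0 : conicEval h₁ h₂ h₃ h₄ h₅ h₆ ⟨1 - 2, 2⟩ = 0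
    · exact ⟨0, 1, by simp, by rw [h0]; ring⟩
    · exact ⟨_, conicEval k₁ k₂ k₃ k₄ k₅ k₆ ⟨1 - 2, 2⟩, fun h => h0 h.1, by ring⟩
  have hc := hcomb h₁ h₂ h₃ h₄ h₅ h₆ m n
  have hzero : m * k₁ - n * h₁ = 0 ∧ m * k₂ - n * h₂ = 0 ∧ m * k₃ - n * h₃ = 0 ∧
      m * k₄ - n * h₄ = 0 ∧ m * k₅ - n * h₅ = 0 ∧ m * k₆ - n * h₆ = 0 := by
    by_contra hne
    have := eq_zero_or_eq_one_of_conicEval hne hABC hA1 hB1 hC1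
      (by
        rw [hc, hhP]
        simp only [conicEval, Complex.one_re, Complex.one_im]
        linear_combination m * hkP)
      (by rw [hc, hhP', hkP']; ring) (by rw [hc, hhA, hkA]; ring) (by rw [hc, hhB, hkB]; ring) (by rw [hc, hhC, hkC]; ring) (τ := 2) (by rw [hc, hmn2])
    norm_num at this
  obtain ⟨e₁, e₂, e₃, e₄, e₅, e₆⟩ := hzero
  have hm : m = 0 := by
    apply (mul_eq_zero.mp _).resolve_right (mul_ne_zero hs hk₁)
    linear_combination e₆ + n * hh₆ - m * hk₆
  have hn : n ≠ 0 := fun h => hmn ⟨hm, h⟩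
  subst hm
  simp [hn] at e₁ e₂ e₃ e₄ e₅ e₆
  exact hh ⟨e₁, e₂, e₃, e₄, e₅, e₆⟩

theorem statement16
    (A B C O : ℂ) (r : ℝ) (Ω : Set ℂ)
    (hr : 0 < r) (hΩ : Ω = circleSet O r)
    (hAΩ : A ∈ Ω) (hBΩ : B ∈ Ω) (hCΩ : C ∈ Ω)
    (hABC : ¬ Collinear ℝ ({A, B, C} : Set ℂ))
    (P P' : ℂ) (hPP' : P ≠ P') (hconj : IsogConj A B C P P')
    (h5 : NoThreeCollinear [A, B, C, P, P'])
    (H : Set ℂ) (hH : IsConic H)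
    (hAH : A ∈ H) (hBH : B ∈ H) (hCH : C ∈ H) (hPH : P ∈ H) (hP'H : P' ∈ H)
    (D : ℂ) (hDΩ : D ∈ Ω) (hDH : D ∈ H) (hDA : D ≠ A) (hDB : D ≠ B) (hDC : D ≠ C)
    (hDP : D ≠ P) (hDP' : D ≠ P')
    (X : ℂ) (hXD : X ≠ D) (hXΩ : X ∈ Ω) (hXline : X ∈ lineThrough D P)
    (Y : ℂ) (hYD : Y ≠ D) (hYΩ : Y ∈ Ω) (hYline : Y ∈ lineThrough D P')
    (hPXY : ¬ Collinear ℝ ({P, X, Y} : Set ℂ))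
    (O₁ : ℂ) (r₁ : ℝ) (hr₁ : 0 < r₁)
    (hPγ : P ∈ circleSet O₁ r₁) (hXγ : X ∈ circleSet O₁ r₁) (hYγ : Y ∈ circleSet O₁ r₁)
    (Z : ℂ) (hZP : Z ≠ P) (hZγ : Z ∈ circleSet O₁ r₁) (hZline : Z ∈ lineThrough P P')
    (h5X : NoThreeCollinear [A, B, C, P, X])
    (C₁ : Set ℂ) (hC₁ : IsConic C₁)
    (hAC₁ : A ∈ C₁) (hBC₁ : B ∈ C₁) (hCC₁ : C ∈ C₁) (hPC₁ : P ∈ C₁) (hXC₁ : X ∈ C₁)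
    (I : ℂ) (hIP : I ≠ P) (hIl : I ∈ lineThrough P Z) (hIC : I ∈ C₁) :
    I ∈ lineThrough X Y := by
  subst hΩ
  have hA4 := cross_ne_zero_of_not_collinear (h5.not_collinear 3 4 0)
  have hB4 := cross_ne_zero_of_not_collinear (h5.not_collinear 3 4 1)
  have hC4 := cross_ne_zero_of_not_collinear (h5.not_collinear 3 4 2)
  have huv : cross (P - D) (P' - D) ≠ 0 :=
    cross_ne_zero_of_mem_conic hH (cross_ne_zero_of_not_collinear hABC) hPP' hA4 hB4 hC4
      hDP hDP' hAH hBH hCH hPH hP'H hDH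
  obtain ⟨s, rfl⟩ := hXline
  obtain ⟨t, rfl⟩ := hYline
  obtain ⟨τ, rfl⟩ : ∃ τ : ℝ, I = P + τ • (P' - P) := by
    obtain ⟨ζ, rfl⟩ := hZline
    obtain ⟨ι, rfl⟩ := hIl
    exact ⟨ι * ζ, by simp [mul_assoc]⟩
  have hs : s ≠ 0 := by rintro rfl; simp at hXD
  have ht : t ≠ 0 := by rintro rfl; simp at hYD
  have hτ : τ ≠ 0 := by rintro rfl; simp at hIP
  obtain ⟨A', rfl⟩ := exists_frame_eq (D := D) huv A
  obtain ⟨B', rfl⟩ := exists_frame_eq (D := D) huv B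
  obtain ⟨C', rfl⟩ := exists_frame_eq (D := D) huv C
  have fD : frame D (P - D) (P' - D) 0 = D := by simp [frame]
  have fP : frame D (P - D) (P' - D) 1 = P := by simp [frame]
  have fP' : frame D (P - D) (P' - D) Complex.I = P' := by simp [frame]
  have fX : frame D (P - D) (P' - D) s = D + s • (P - D) := by simp [frame]
  have fY : frame D (P - D) (P' - D) ⟨0, t⟩ = D + t • (P' - D) := by simp [frame]
  have fI : frame D (P - D) (P' - D) ⟨1 - τ, τ⟩ = P + τ • (P' - P) := by
    simp [frame]
    ring
  obtain ⟨h₁, h₂, h₃, h₄, h₅, h₆, hh, hhS⟩ := hH.exists_conicEval_frame (D := D) huv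
  obtain ⟨k₁, k₂, k₃, k₄, k₅, k₆, hk, hkS⟩ := hC₁.exists_conicEval_frame (D := D) huv
  obtain ⟨w₁, w₂, w₃, w₄, w₅, w₆, hw, hwS⟩ := exists_conicEval_frame_of_circle O r (D := D) huv
  have hABC' := cross_ne_zero_of_not_collinear_frame hABC
  have him : ∀ z : ℂ, ¬ Collinear ℝ ({frame D (P - D) (P' - D) z, P, D + s • (P - D)} : Set ℂ) →
      z.im ≠ 0 ∧ s ≠ 1 := by
    intro z hz
    have hz' := cross_ne_zero_of_not_collinear_frame (D := D) (u := P - D) (v := P' - D)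
      (z₁ := z) (z₂ := 1) (z₃ := s) (by rwa [fP, fX])
    constructor <;> intro h0 <;> apply hz' <;> simp [cross, h0]
    ring
  have hsum : ∀ z : ℂ, ¬ Collinear ℝ ({frame D (P - D) (P' - D) z, P, P'} : Set ℂ) →
      z.re + z.im - 1 ≠ 0 := by
    intro z hz h0
    apply cross_ne_zero_of_not_collinear_frame (D := D) (u := P - D) (v := P' - D)
      (z₁ := z) (z₂ := 1) (z₃ := Complex.I) (by rwa [fP, fP'])
    simp [cross]
    linear_combination -h0
  have hone : ∀ z w : ℂ, ¬ Collinear ℝ ({P, frame D (P - D) (P' - D) z,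
      frame D (P - D) (P' - D) w} : Set ℂ) → cross (z - 1) (w - 1) ≠ 0 := fun z w h =>
    cross_ne_zero_of_not_collinear_frame (D := D) (u := P - D) (v := P' - D) (by rwa [fP])
  have hI : ∀ z w : ℂ, ¬ Collinear ℝ ({frame D (P - D) (P' - D) z, frame D (P - D) (P' - D) w,
      P'} : Set ℂ) → cross (w - z) (Complex.I - z) ≠ 0 := fun z w h =>
    cross_ne_zero_of_not_collinear_frame (D := D) (u := P - D) (v := P' - D) (by rwa [fP'])
  have hne0 : ∀ z : ℂ, D ≠ frame D (P - D) (P' - D) z → z ≠ 0 := by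
    rintro z hz rfl
    exact hz fD.symm
  rw [← fX] at hXΩ hXC₁
  rw [← fY] at hYΩ
  rw [← fI] at hIC
  have hhA := (hhS _).mp hAH
  have hhB := (hhS _).mp hBH
  have hhC := (hhS _).mp hCH
  have hhD := (hhS 0).mp (by rwa [fD])
  have hhP := (hhS 1).mp (by rwa [fP])
  have hhP' := (hhS Complex.I).mp (by rwa [fP'])
  have hAim := him A' (h5X.not_collinear 0 3 4)
  have hBim := him B' (h5X.not_collinear 1 3 4)
  have hCim := him C' (h5X.not_collinear 2 3 4)
  have key := collinear_of_conics_in_frame hABC'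
    (re_ne_zero_of_conicEval hh
      (hone B' C' (h5.not_collinear 3 1 2))
      (hI A' B' (h5.not_collinear 0 1 4))
      (hI A' C' (h5.not_collinear 0 2 4))
      (hne0 _ hDA) hhD hhP hhP' hhA hhB hhC)
    (re_ne_zero_of_conicEval hh
      (hone A' C' (h5.not_collinear 3 0 2))
      (hI B' A' (h5.not_collinear 1 0 4))
      (hI B' C' (h5.not_collinear 1 2 4))
      (hne0 _ hDB) hhD hhP hhP' hhB hhA hhC)
    (re_ne_zero_of_conicEval hh
      (hone A' B' (h5.not_collinear 3 0 1))
      (hI C' A' (h5.not_collinear 2 0 4))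
      (hI C' B' (h5.not_collinear 2 1 4))
      (hne0 _ hDC) hhD hhP hhP' hhC hhA hhB)
    hAim.1 hBim.1 hCim.1
    (hsum A' (h5.not_collinear 0 3 4))
    (hsum B' (h5.not_collinear 1 3 4))
    (hsum C' (h5.not_collinear 2 3 4))
    hs hAim.2 ht hτ hh hw hk hhA hhB hhC hhD hhP hhP'
    (hwS _ hAΩ) (hwS _ hBΩ) (hwS _ hCΩ) (hwS 0 (by rwa [fD])) (hwS _ hXΩ) (hwS _ hYΩ)
    ((hkS _).mp hAC₁) ((hkS _).mp hBC₁) ((hkS _).mp hCC₁) ((hkS 1).mp (by rwa [fP]))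
    ((hkS _).mp hXC₁) ((hkS _).mp hIC)
  have hτt : τ / t * t = τ := div_mul_cancel₀ τ ht
  have hτs : 1 - τ = s * (1 - τ / t) := by
    apply mul_left_cancel₀ ht
    linear_combination key + s * hτt
  refine ⟨τ / t, ?_⟩
  apply Complex.ext <;>
    simp only [Complex.add_re, Complex.add_im, Complex.smul_re, Complex.smul_im, smul_eq_mul,
      Complex.sub_re, Complex.sub_im]
  · linear_combination (P.re - D.re) * hτs - (P'.re - D.re) * hτt
  · linear_combination (P.im - D.im) * hτs - (P'.im - D.im) * hτt


end
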